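/- If two permutations π and σ are equivalent under the bidirectional replacement 123 ↔ 13★, then π and σ have the same number of left-to-right minima; moreover, if π has at least one element that is not a left-to-right minimum, then so does σ, and in addition: (i) the position (from the left) of the leftmost non-left-to-right-minimum element is the same in π and σ, and (ii) the number of left-to-right minima whose value is less than the value of the largest non-left-to-right-minimum element is the same in π and σ. -/

import Mathlib

/-!
Pattern-replacement equivalences between permutations of different lengths
(arXiv:1309.4802). A ★-pattern is encoded as a `List (Option ℕ)`, where `none`
is the placeholder ★ and `some k` an integer entry.
-/

/-- A ★-pattern / star-string entry: `none` is ★, `some k` an integer `k`. -/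
abbrev SPat := List (Option ℕ)

/-- The integer entries of a star-string, in order. -/
def ints (ρ : SPat) : List ℕ := ρ.filterMap id

/-- Two lists of naturals are order-isomorphic. -/
def OrdIso (u v : List ℕ) : Prop :=
  u.length = v.length ∧
  ∀ i j, i < u.length → j < u.length → (u.getD i 0 < u.getD j 0 ↔ v.getD i 0 < v.getD j 0)

/-- A valid string of distinct positive integers and ★'s. -/
def StarStr (ρ : SPat) : Prop := (ints ρ).Nodup ∧ ∀ k ∈ ints ρ, 0 < k

/-- `r` (entry by entry) forms a copy of the ★-pattern `δ`: ★'s in the same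
positions, and the integer entries order-isomorphic. -/
def IsCopy (r δ : SPat) : Prop :=
  r.length = δ.length ∧
  (∀ i, (r.getD i none = none ↔ δ.getD i none = none)) ∧
  OrdIso (ints r) (ints δ)

/-- `Repl a b ρ₁ ρ₂` : `ρ₂` is obtained from `ρ₁` by replacing an occurrence of `a`
as a (not necessarily contiguous) substring of `ρ₁` by `b`, entry by entry at the
same positions. -/
inductive Repl : SPat → SPat → SPat → SPat → Prop
  | nil : Repl [] [] [] []
  | keep {a b ρ₁ ρ₂} (x : Option ℕ) : Repl a b ρ₁ ρ₂ → Repl a b (x :: ρ₁) (x :: ρ₂)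
  | repl {a b ρ₁ ρ₂} (x y : Option ℕ) :
      Repl a b ρ₁ ρ₂ → Repl (x :: a) (y :: b) (x :: ρ₁) (y :: ρ₂)

/-- `π` is a permutation of `1, …, n` (as a list). -/
def IsPermList (π : List ℕ) : Prop := π.Perm (List.range' 1 π.length)

/-- `σ` is a result of the replacement `α → β` applied to the permutation `π`:
(1) `ρ₁` is `π` renumbered (order-isomorphically) with ★'s inserted anywhere;
(2) a substring `a` of `ρ₁` forming a copy of `α` is replaced (in place) by a
string `b` that is a copy of `β`, whose integers meet `ρ₁` only inside `a`, and
which agrees with `a` on the integer entries common to `α` and `β`;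
(3) dropping ★'s and renumbering gives the permutation `σ`. -/
def IsResult (α β : SPat) (π σ : List ℕ) : Prop :=
  ∃ ρ₁ ρ₂ a b : SPat,
    StarStr ρ₁ ∧ OrdIso π (ints ρ₁) ∧
    IsCopy a α ∧
    StarStr b ∧ IsCopy b β ∧
    (∀ k ∈ ints b, k ∈ ints ρ₁ → k ∈ ints a) ∧
    (∀ i j x, α.getD i none = some x → β.getD j none = some x →
      a.getD i none = b.getD j none) ∧
    Repl a b ρ₁ ρ₂ ∧
    IsPermList σ ∧ OrdIso (ints ρ₂) σ

/-- Equivalence under the bidirectional replacement `α ↔ β`: a finite sequence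
of `α → β` and `β → α` replacements. -/
def PermEquiv (α β : SPat) (π σ : List ℕ) : Prop :=
  Relation.ReflTransGen (fun τ υ => IsResult α β τ υ ∨ IsResult β α τ υ) π σ

/-- `π` is isolated under `α ↔ β`: no other permutation is equivalent to it. -/
def Isolated (α β : SPat) (π : List ℕ) : Prop :=
  ∀ σ : List ℕ, IsPermList σ → PermEquiv α β π σ → σ = π

/-- The identity permutation `1 2 ⋯ n`. -/
def idPerm (n : ℕ) : List ℕ := List.range' 1 n

/-- The reverse identity permutation `n (n-1) ⋯ 1`. -/
def ridPerm (n : ℕ) : List ℕ := (List.range' 1 n).reverse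

def pat123 : SPat := [some 1, some 2, some 3]
def pat132 : SPat := [some 1, some 3, some 2]
def patS32 : SPat := [none, some 3, some 2]
def pat3S2 : SPat := [some 3, none, some 2]
def pat32S : SPat := [some 3, some 2, none]
def patS31 : SPat := [none, some 3, some 1]
def pat3S1 : SPat := [some 3, none, some 1]
def pat31S : SPat := [some 3, some 1, none]
def patS21 : SPat := [none, some 2, some 1]
def pat2S1 : SPat := [some 2, none, some 1]
def pat21S : SPat := [some 2, some 1, none]
def pat12S : SPat := [some 1, some 2, none]
def pat1S3 : SPat := [some 1, none, some 3]
def patS23 : SPat := [none, some 2, some 3]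
def patS12 : SPat := [none, some 1, some 2]
def pat23S : SPat := [some 2, some 3, none]
def pat13S : SPat := [some 1, some 3, none]
def pat1S2 : SPat := [some 1, none, some 2]

/-- The entry at (0-indexed) position `i` of `π` is a left-to-right minimum. -/
def IsLRMin (π : List ℕ) (i : ℕ) : Prop := ∀ j < i, π.getD i 0 < π.getD j 0

instance (π : List ℕ) (i : ℕ) : Decidable (IsLRMin π i) := by
  unfold IsLRMin; infer_instance

/-- The number of left-to-right minima of `π`. -/
def numLRMin (π : List ℕ) : ℕ :=
  ((List.range π.length).filter fun i => decide (IsLRMin π i)).length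

/-- `π` has at least one element that is not a left-to-right minimum. -/
def HasNonMin (π : List ℕ) : Prop := ∃ i < π.length, ¬ IsLRMin π i

/-- The 0-indexed position of the leftmost non-left-to-right-minimum, if any. -/
def leftNonMin (π : List ℕ) : Option ℕ :=
  (List.range π.length).find? fun i => ! decide (IsLRMin π i)

/-- The 0-indexed position of the rightmost non-left-to-right-minimum, if any. -/
def rightNonMin (π : List ℕ) : Option ℕ :=
  (List.range π.length).reverse.find? fun i => ! decide (IsLRMin π i)

/-- The values of the non-left-to-right-minimum entries of `π`. -/
def nonMinVals (π : List ℕ) : List ℕ :=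
  ((List.range π.length).filter fun i => ! decide (IsLRMin π i)).map fun i => π.getD i 0

/-- The largest non-left-to-right-minimum value of `π`. -/
def maxNonMin (π : List ℕ) : ℕ := (nonMinVals π).foldr max 0

/-- The smallest non-left-to-right-minimum value of `π`. -/
def minNonMin (π : List ℕ) : ℕ := (nonMinVals π).foldr min π.length

/-- The number of left-to-right minima of `π` whose value is less than the
value of the largest non-left-to-right-minimum element. -/
def vStatMax (π : List ℕ) : ℕ :=
  ((List.range π.length).filter fun i =>
    decide (IsLRMin π i) && decide (π.getD i 0 < maxNonMin π)).length

/-- The number of left-to-right minima of `π` whose value is less than the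
value of the smallest non-left-to-right-minimum element. -/
def vStatMin (π : List ℕ) : ℕ :=
  ((List.range π.length).filter fun i =>
    decide (IsLRMin π i) && decide (π.getD i 0 < minNonMin π)).length

/-- Two lists agree on all the statistics. -/
def SameStats (u v : List ℕ) : Prop :=
  numLRMin u = numLRMin v ∧ (HasNonMin u ↔ HasNonMin v) ∧
    leftNonMin u = leftNonMin v ∧ vStatMax u = vStatMax v

theorem SameStats.symm {u v : List ℕ} (h : SameStats u v) : SameStats v u :=
  ⟨h.1.symm, h.2.1.symm, h.2.2.1.symm, h.2.2.2.symm⟩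

theorem SameStats.trans {u v w : List ℕ} (h : SameStats u v) (k : SameStats v w) :
    SameStats u w :=
  ⟨h.1.trans k.1, h.2.1.trans k.2.1, h.2.2.1.trans k.2.2.1, h.2.2.2.trans k.2.2.2⟩

theorem lt_foldr_max (l : List ℕ) (a : ℕ) : a < l.foldr max 0 ↔ ∃ b ∈ l, a < b := by
  induction l with
  | nil => simp
  | cons c l ih => simp [ih]

theorem lt_maxNonMin (u : List ℕ) (a : ℕ) :
    a < maxNonMin u ↔ ∃ j < u.length, ¬ IsLRMin u j ∧ a < u.getD j 0 := by
  rw [maxNonMin, lt_foldr_max]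
  simp only [nonMinVals, List.mem_map, List.mem_filter, List.mem_range]
  constructor
  · rintro ⟨b, ⟨j, ⟨hj, hj'⟩, rfl⟩, h⟩
    exact ⟨j, hj, by simpa using hj', h⟩
  · rintro ⟨j, hj, hj', h⟩
    exact ⟨_, ⟨j, ⟨hj, by simpa using hj'⟩, rfl⟩, h⟩

theorem find?_congr_mem {α : Type*} (l : List α) (p q : α → Bool) (h : ∀ a ∈ l, p a = q a) :
    l.find? p = l.find? q := by
  induction l with
  | nil => rfl
  | cons a l ih =>
    simp only [List.find?_cons, h a List.mem_cons_self,
      ih (fun b hb => h b (List.mem_cons_of_mem _ hb))]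

theorem sameStats_of_ordIso {u v : List ℕ} (h : OrdIso u v) : SameStats u v := by
  obtain ⟨hl, h⟩ := h
  have hm : ∀ i < u.length, (IsLRMin u i ↔ IsLRMin v i) := by
    intro i hi
    unfold IsLRMin
    exact forall₂_congr fun j hj => h i j hi (by omega)
  have hx : ∀ i < u.length, (u.getD i 0 < maxNonMin u ↔ v.getD i 0 < maxNonMin v) := by
    intro i hi
    rw [lt_maxNonMin, lt_maxNonMin, ← hl]
    refine exists_congr fun j => and_congr_right fun hj => ?_
    rw [hm j hj, h i j hi hj]
  refine ⟨?_, ?_, ?_, ?_⟩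
  · unfold numLRMin
    rw [← hl]
    congr 1
    apply List.filter_congr
    intro i hi
    simp [hm i (List.mem_range.1 hi)]
  · unfold HasNonMin
    rw [← hl]
    exact exists_congr fun j => and_congr_right fun hj => not_congr (hm j hj)
  · unfold leftNonMin
    rw [← hl]
    apply find?_congr_mem
    intro i hi
    simp [hm i (List.mem_range.1 hi)]
  · unfold vStatMax
    rw [← hl]
    congr 1
    apply List.filter_congr
    intro i hi
    have hi := List.mem_range.1 hi
    rw [decide_eq_decide.2 (hm i hi), decide_eq_decide.2 (hx i hi)]

/-- The left-to-right minima (`c = true`) or non-minima (`c = false`) of `l` with prefix `p`. -/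
def selAux (c : Bool) : List ℕ → List ℕ → List ℕ
  | _, [] => []
  | p, a :: l =>
    if decide (∀ b ∈ p, a < b) = c then a :: selAux c (p ++ [a]) l else selAux c (p ++ [a]) l

theorem selAux_append (c : Bool) (p l m : List ℕ) :
    selAux c p (l ++ m) = selAux c p l ++ selAux c (p ++ l) m := by
  induction l generalizing p with
  | nil => simp [selAux]
  | cons a l ih =>
    simp only [List.cons_append, selAux, ih]
    split_ifs <;> simp

theorem selAux_congr (c : Bool) (p q l : List ℕ)
    (h : ∀ a, (∀ b ∈ p, a < b) ↔ (∀ b ∈ q, a < b)) : selAux c p l = selAux c q l := by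
  induction l generalizing p q with
  | nil => rfl
  | cons a l ih =>
    have := ih (p ++ [a]) (q ++ [a]) (by
      intro d
      simp only [List.forall_mem_append, h d])
    simp only [selAux, this, h a]

theorem isLRMin_iff (p : List ℕ) (a : ℕ) (l : List ℕ) :
    IsLRMin (p ++ a :: l) p.length ↔ ∀ b ∈ p, a < b := by
  have h0 : (p ++ a :: l).getD p.length 0 = a := by simp
  unfold IsLRMin
  rw [h0]
  constructor
  · intro h b hb
    obtain ⟨j, hj, rfl⟩ := List.getElem_of_mem hb
    have := h j hj
    rw [List.getD_append _ _ _ _ hj, List.getD_eq_getElem _ _ hj] at this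
    exact this
  · intro h j hj
    rw [List.getD_append _ _ _ _ hj, List.getD_eq_getElem _ _ hj]
    exact h _ (List.getElem_mem _)

theorem selAux_eq (c : Bool) (p l : List ℕ) :
    selAux c p l = ((List.range l.length).filter
      fun i => decide (IsLRMin (p ++ l) (p.length + i)) == c).map
        fun i => (p ++ l).getD (p.length + i) 0 := by
  induction l generalizing p with
  | nil => rfl
  | cons a l ih =>
    have h0 : (p ++ a :: l).getD p.length 0 = a := by simp
    have e : p ++ [a] ++ l = p ++ a :: l := by simp
    have ih' := ih (p ++ [a])
    rw [e] at ih'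
    have h1 : ∀ i, (p ++ [a]).length + i = p.length + (i + 1) := by
      intro i; simp; omega
    simp only [h1] at ih'
    rw [List.length_cons, List.range_succ_eq_map, List.filter_cons, selAux, ih']
    have h2 : (decide (IsLRMin (p ++ a :: l) (p.length + 0)) == c) = true ↔
        decide (∀ b ∈ p, a < b) = c := by
      simp only [Nat.add_zero, isLRMin_iff p a l, beq_iff_eq]
    by_cases hc : decide (∀ b ∈ p, a < b) = c
    · rw [if_pos hc, if_pos (h2.2 hc), List.map_cons, List.filter_map, List.map_map, Nat.add_zero,
        h0]
      rfl
    · rw [if_neg hc, if_neg (fun h => hc (h2.1 h)), List.filter_map, List.map_map]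
      rfl

theorem selAux_true (l : List ℕ) :
    selAux true [] l = ((List.range l.length).filter
      fun i => decide (IsLRMin l i)).map fun i => l.getD i 0 := by
  rw [selAux_eq]; simp

theorem selAux_false (l : List ℕ) : selAux false [] l = nonMinVals l := by
  rw [selAux_eq, nonMinVals]; simp

theorem numLRMin_eq (l : List ℕ) : numLRMin l = (selAux true [] l).length := by
  rw [selAux_true, List.length_map, numLRMin]

theorem vStatMax_eq (l : List ℕ) : vStatMax l =
    ((selAux true [] l).filter fun a => decide (a < maxNonMin l)).length := by
  rw [selAux_true, List.filter_map, List.length_map, List.filter_filter, vStatMax]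
  congr 1
  apply List.filter_congr
  intro i _
  simp [Bool.and_comm]

theorem leftNonMin_prefix (p : List ℕ) (x a b : ℕ) (l m : List ℕ) (hx : x ∈ p) (ha : x < a)
    (hb : x < b) : leftNonMin (p ++ a :: l) = leftNonMin (p ++ b :: m) := by
  have key : ∀ (c : ℕ) (r : List ℕ), x < c → leftNonMin (p ++ c :: r) =
      ((List.range p.length).find? fun i => ! decide (IsLRMin p i)).or (some p.length) := by
    intro c r hc
    have hn : ¬ IsLRMin (p ++ c :: r) p.length := by
      rw [isLRMin_iff]
      intro h
      have := h x hx
      omega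
    unfold leftNonMin
    have : (p ++ c :: r).length = p.length + (r.length + 1) := by simp
    rw [this, List.range_add, List.find?_append, List.range_succ_eq_map, List.map_cons,
      List.find?_cons_of_pos (by simpa using hn)]
    congr 1
    apply find?_congr_mem
    intro i hi
    have hi := List.mem_range.1 hi
    congr 1
    apply decide_eq_decide.2
    unfold IsLRMin
    refine forall₂_congr fun j hj => ?_
    rw [List.getD_append _ _ _ _ hi, List.getD_append _ _ _ _ (hj.trans hi)]
  rw [key a l ha, key b m hb]

theorem hasNonMin_of (p : List ℕ) (x a : ℕ) (l : List ℕ) (hx : x ∈ p) (ha : x < a) :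
    HasNonMin (p ++ a :: l) := by
  refine ⟨p.length, by simp, ?_⟩
  rw [isLRMin_iff]
  intro h
  have := h x hx
  omega

theorem sel_step (c : Bool) (p C D : List ℕ) (x y z : ℕ) (hx : x ∈ p) (hxy : x < y) (hyz : y < z) :
    selAux c [] (p ++ y :: (C ++ z :: D)) =
      selAux c [] p ++ ((if c then [] else [y]) ++ (selAux c p C ++
        ((if c then [] else [z]) ++ selAux c (p ++ C) D))) ∧
    selAux c [] (p ++ z :: (C ++ D)) =
      selAux c [] p ++ ((if c then [] else [z]) ++ (selAux c p C ++ selAux c (p ++ C) D)) := by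
  have hcons : ∀ (q l : List ℕ) (a : ℕ), x ∈ q → x < a →
      selAux c q (a :: l) = (if c then [] else [a]) ++ selAux c q l := by
    intro q l a hq ha
    have hn : ¬ ∀ b ∈ q, a < b := fun h => by have := h x hq; omega
    have hs : selAux c (q ++ [a]) l = selAux c q l := by
      apply selAux_congr
      intro d
      simp only [List.forall_mem_append, List.mem_singleton, forall_eq, and_iff_left_iff_imp]
      intro h
      have := h x hq
      omega
    rw [selAux, hs, decide_eq_false hn]
    cases c <;> simp
  constructor
  · rw [selAux_append, List.nil_append, hcons _ _ _ hx hxy, selAux_append,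
      hcons _ _ _ (by simp [hx]) (hxy.trans hyz)]
  · rw [selAux_append, List.nil_append, hcons _ _ _ hx (hxy.trans hyz), selAux_append]

theorem sameStats_step (p C D : List ℕ) (x y z : ℕ) (hx : x ∈ p) (hxy : x < y) (hyz : y < z) :
    SameStats (p ++ y :: (C ++ z :: D)) (p ++ z :: (C ++ D)) := by
  have ht := sel_step true p C D x y z hx hxy hyz
  have hf := sel_step false p C D x y z hx hxy hyz
  have hm : selAux true [] (p ++ y :: (C ++ z :: D)) = selAux true [] (p ++ z :: (C ++ D)) := by
    rw [ht.1, ht.2]; simp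
  have hM : ∀ a, a < maxNonMin (p ++ y :: (C ++ z :: D)) ↔ a < maxNonMin (p ++ z :: (C ++ D)) := by
    intro a
    rw [maxNonMin, maxNonMin, ← selAux_false, ← selAux_false, hf.1, hf.2, lt_foldr_max,
      lt_foldr_max]
    constructor
    · rintro ⟨b, hb, h⟩
      simp only [List.mem_append, Bool.false_eq_true, if_false, List.mem_singleton] at hb
      rcases hb with hb | rfl | hb | rfl | hb
      · exact ⟨b, by simp [hb], h⟩
      · exact ⟨z, by simp, by omega⟩
      · exact ⟨b, by simp [hb], h⟩
      · exact ⟨b, by simp, h⟩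
      · exact ⟨b, by simp [hb], h⟩
    · rintro ⟨b, hb, h⟩
      simp only [List.mem_append, Bool.false_eq_true, if_false, List.mem_singleton] at hb
      rcases hb with hb | rfl | hb | hb
      · exact ⟨b, by simp [hb], h⟩
      · exact ⟨b, by simp, h⟩
      · exact ⟨b, by simp [hb], h⟩
      · exact ⟨b, by simp [hb], h⟩
  refine ⟨?_, ?_, ?_, ?_⟩
  · rw [numLRMin_eq, numLRMin_eq, hm]
  · exact iff_of_true (hasNonMin_of _ x _ _ hx hxy) (hasNonMin_of _ x _ _ hx (hxy.trans hyz))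
  · exact leftNonMin_prefix _ x _ _ _ _ hx hxy (hxy.trans hyz)
  · rw [vStatMax_eq, vStatMax_eq, hm]
    simp only [hM]

theorem repl_nil {a b ρ₁ ρ₂ : SPat} (h : Repl a b ρ₁ ρ₂) (ha : a = []) (hb : b = []) :
    ρ₁ = ρ₂ := by
  induction h with
  | nil => rfl
  | keep x _ ih => rw [ih ha hb]
  | repl x y _ _ => simp at ha

theorem repl_cons {a b ρ₁ ρ₂ a' b' : SPat} {x y : Option ℕ} (h : Repl a b ρ₁ ρ₂)
    (ha : a = x :: a') (hb : b = y :: b') :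
    ∃ P r₁ r₂, ρ₁ = P ++ x :: r₁ ∧ ρ₂ = P ++ y :: r₂ ∧ Repl a' b' r₁ r₂ := by
  induction h with
  | nil => simp at ha
  | keep w _ ih =>
    obtain ⟨P, r₁, r₂, rfl, rfl, h⟩ := ih ha hb
    exact ⟨w :: P, r₁, r₂, rfl, rfl, h⟩
  | repl u v h _ =>
    simp only [List.cons.injEq] at ha hb
    obtain ⟨rfl, rfl⟩ := ha
    obtain ⟨rfl, rfl⟩ := hb
    exact ⟨[], _, _, rfl, rfl, h⟩

theorem repl_three {a₀ a₁ a₂ b₀ b₁ b₂ : Option ℕ} {ρ₁ ρ₂ : SPat}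
    (h : Repl [a₀, a₁, a₂] [b₀, b₁, b₂] ρ₁ ρ₂) :
    ∃ A B C D, ρ₁ = A ++ a₀ :: (B ++ a₁ :: (C ++ a₂ :: D)) ∧
      ρ₂ = A ++ b₀ :: (B ++ b₁ :: (C ++ b₂ :: D)) := by
  obtain ⟨A, r1, s1, rfl, rfl, h1⟩ := repl_cons h rfl rfl
  obtain ⟨B, r2, s2, rfl, rfl, h2⟩ := repl_cons h1 rfl rfl
  obtain ⟨C, r, s, rfl, rfl, h3⟩ := repl_cons h2 rfl rfl
  obtain rfl := repl_nil h3 rfl rfl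
  exact ⟨A, B, C, r, rfl, rfl⟩

theorem copy_123 {a : SPat} (h : IsCopy a pat123) :
    ∃ x y z, a = [some x, some y, some z] ∧ x < y ∧ y < z := by
  obtain ⟨hl, hs, -, ho⟩ := h
  obtain ⟨a₀, a₁, a₂, rfl⟩ := List.length_eq_three.1 hl
  have h0 := hs 0
  have h1 := hs 1
  have h2 := hs 2
  rcases a₀ with _ | x <;> rcases a₁ with _ | y <;> rcases a₂ with _ | z <;>
    simp [pat123] at h0 h1 h2
  have o1 := ho 0 1 (by simp [ints]) (by simp [ints])
  have o2 := ho 1 2 (by simp [ints]) (by simp [ints])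
  simp [ints, pat123] at o1 o2
  exact ⟨x, y, z, rfl, o1, o2⟩

theorem copy_13S {a : SPat} (h : IsCopy a pat13S) :
    ∃ x z, a = [some x, some z, none] := by
  obtain ⟨hl, hs, -, ho⟩ := h
  obtain ⟨a₀, a₁, a₂, rfl⟩ := List.length_eq_three.1 hl
  have h0 := hs 0
  have h1 := hs 1
  have h2 := hs 2
  rcases a₀ with _ | x <;> rcases a₁ with _ | y <;> rcases a₂ with _ | z <;>
    simp [pat13S] at h0 h1 h2
  exact ⟨x, y, rfl⟩

theorem sameStats_ints (A B C D : SPat) (x y z : ℕ) (hxy : x < y) (hyz : y < z) :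
    SameStats (ints (A ++ some x :: (B ++ some y :: (C ++ some z :: D))))
      (ints (A ++ some x :: (B ++ some z :: (C ++ none :: D)))) := by
  have := sameStats_step (ints A ++ x :: ints B) (ints C) (ints D) x y z (by simp) hxy hyz
  simpa [ints] using this

theorem sameStats_result {π σ : List ℕ} (h : IsResult pat123 pat13S π σ) : SameStats π σ := by
  obtain ⟨ρ₁, ρ₂, a, b, -, h1, ha, -, hb, -, hc, hr, -, h2⟩ := h
  refine (sameStats_of_ordIso h1).trans (SameStats.trans ?_ (sameStats_of_ordIso h2))
  obtain ⟨x, y, z, rfl, hxy, hyz⟩ := copy_123 ha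
  obtain ⟨x', z', rfl⟩ := copy_13S hb
  have c1 := hc 0 0 1 rfl rfl
  have c2 := hc 2 1 3 rfl rfl
  simp at c1 c2
  subst c1 c2
  obtain ⟨A, B, C, D, rfl, rfl⟩ := repl_three hr
  exact sameStats_ints A B C D _ _ _ hxy hyz

theorem sameStats_result' {π σ : List ℕ} (h : IsResult pat13S pat123 π σ) : SameStats π σ := by
  obtain ⟨ρ₁, ρ₂, a, b, -, h1, ha, -, hb, -, hc, hr, -, h2⟩ := h
  refine (sameStats_of_ordIso h1).trans (SameStats.trans ?_ (sameStats_of_ordIso h2))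
  obtain ⟨x, y, z, rfl, hxy, hyz⟩ := copy_123 hb
  obtain ⟨x', z', rfl⟩ := copy_13S ha
  have c1 := hc 0 0 1 rfl rfl
  have c2 := hc 1 2 3 rfl rfl
  simp at c1 c2
  subst c1 c2
  obtain ⟨A, B, C, D, rfl, rfl⟩ := repl_three hr
  exact (sameStats_ints A B C D _ _ _ hxy hyz).symm

theorem sameStats_equiv {π σ : List ℕ} (h : PermEquiv pat123 pat13S π σ) : SameStats π σ := by
  unfold PermEquiv at h
  induction h with
  | refl => exact ⟨rfl, Iff.rfl, rfl, rfl⟩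
  | tail _ h ih => exact ih.trans (h.elim sameStats_result sameStats_result')

/-- equivalence under `123 ↔ 13★` preserves the number of
left-to-right minima; and if `π` has a non-left-to-right-minimum element then so
does `σ`, the (0-indexed) position of the leftmost such element is the same, and
the number of left-to-right minima smaller than the largest such element is the
same. -/
theorem invariants_13star (π σ : List ℕ) (hπ : IsPermList π) (hσ : IsPermList σ)
    (h : PermEquiv pat123 pat13S π σ) :
    numLRMin π = numLRMin σ ∧
    (HasNonMin π → HasNonMin σ ∧
      leftNonMin π = leftNonMin σ ∧ vStatMax π = vStatMax σ) := by
  have hs := sameStats_equiv h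
  exact ⟨hs.1, fun hn => ⟨hs.2.1.1 hn, hs.2.2.1, hs.2.2.2⟩⟩
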